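/- arXiv:2007.10144 — 2 statements merged into one kernel-verified Lean document; each statement's English description precedes it below -/
import Mathlib

section
/- Assume the HardMax response function with f_resp(0) = 1, i.e. ties are always broken in favor of principal 1. If principal 1's algorithm ALG_1 is StaticGreedy, then all T agents choose principal 1, regardless of principal 2's algorithm. -/
/-
A formalization of the Bayesian-choice model of competing bandits.

Two principals each commit to a multi-armed bandit algorithm over a finite set
`A` of arms with Bernoulli rewards.  The mean-reward vector `w : A → ℝ` is drawn
once from a common Bayesian prior `P`.  An algorithm is a map from (reversed)
histories of (arm, reward) pairs to distributions over arms.  Agents arrive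
sequentially; agent `t` (rounds are 1-indexed) chooses principal 1 with
probability `fresp (PMR₁(t) - PMR₂(t))`, where `PMRᵢ(t)` is the Bayesian
posterior mean reward of principal `i`'s next local step; the chosen principal's
algorithm advances one local step.
-/

open MeasureTheory
open scoped Classical

namespace BayesianChoice

/-- A history: a list of (arm, Bernoulli reward) pairs, most recent step first. -/
abbrev History (A : Type) := List (A × Bool)

/-- An MAB algorithm: a distribution over arms, given the observed history.
(Note that such algorithms never depend on the time horizon `T`:
they are automatically `T`-oblivious.) -/
abbrev Alg (A : Type) := History A → PMF A

variable {A : Type} [Fintype A] [Nonempty A]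

/-- Likelihood of the reward sequence in history `h`, given mean-reward vector `w`
(rewards are Bernoulli, independent across steps given `w`). -/
noncomputable def lik (w : A → ℝ) : History A → ℝ
  | [] => 1
  | (a, r) :: h => lik w h * (if r then w a else 1 - w a)

/-- Probability that a stand-alone run of `alg` produces history `h`, given `w`. -/
noncomputable def hProb (alg : Alg A) (w : A → ℝ) : History A → ℝ
  | [] => 1
  | (a, r) :: h => hProb alg w h * ((alg h) a).toReal * (if r then w a else 1 - w a)

variable (P : Measure (A → ℝ))

/-- The prior `P` is supported on mean rewards in `[0,1]` (Bernoulli parameters). -/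
def PriorOnUnitCube : Prop := P {w | ∀ a : A, w a ∈ Set.Icc (0:ℝ) 1} = 1

/-- A history is feasible if it has positive marginal likelihood under the prior. -/
def Feasible (h : History A) : Prop := 0 < ∫ w, lik w h ∂P

/-- Posterior mean reward `E[μ_a | h]` of arm `a` given history `h`. -/
noncomputable def postMean (h : History A) (a : A) : ℝ :=
  (∫ w, w a * lik w h ∂P) / ∫ w, lik w h ∂P

/-- Prior assumption (i): each arm can be the (strictly) best arm. -/
def EachArmCanBeBest : Prop := ∀ a : A, 0 < P {w | ∀ a' : A, a' ≠ a → w a' < w a}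

/-- Prior assumption (ii): posterior mean rewards are pairwise distinct
given any feasible history. -/
def DistinctPosteriorMeans : Prop :=
  ∀ h : History A, Feasible P h → ∀ a a' : A, a ≠ a' → postMean P h a ≠ postMean P h a'

/-- `alg` is (a version of) `BayesGreedy`: on every feasible history it only plays arms
with the largest posterior mean reward. -/
def IsBayesGreedy (alg : Alg A) : Prop :=
  ∀ h : History A, Feasible P h →
    ∀ a ∈ (alg h).support, ∀ a' : A, postMean P h a' ≤ postMean P h a

/-- `alg` is (a version of) `StaticGreedy`: it always plays an arm with the largest
prior mean reward. -/
def IsStaticGreedy (alg : Alg A) : Prop :=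
  ∀ h : History A, ∀ a ∈ (alg h).support,
    ∀ a' : A, postMean P ([] : History A) a' ≤ postMean P ([] : History A) a

/-- Marginal probability that a stand-alone run of `alg` produces history `h`. -/
noncomputable def prH (alg : Alg A) (h : History A) : ℝ := ∫ w, hProb alg w h ∂P

/-- `alg` and `alg'` deviate at (local, 1-indexed) step `n`: there is a set `H` of
histories over the previous `n-1` steps, reached with positive probability by both
algorithms, on which they choose different distributions over arms. -/
def DeviatesAt (alg alg' : Alg A) (n : ℕ) : Prop :=
  ∃ H : Set (History A),
    (∀ h ∈ H, h.length + 1 = n) ∧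
    (∃ h ∈ H, 0 < prH P alg h) ∧ (∃ h ∈ H, 0 < prH P alg' h) ∧
    (∀ h ∈ H, alg h ≠ alg' h)

/-- `alg` deviates from `alg'` starting from step `n₀`:
`n₀` is the smallest step at which they deviate. -/
def DeviatesFrom (alg alg' : Alg A) (n₀ : ℕ) : Prop :=
  DeviatesAt P alg alg' n₀ ∧ ∀ n < n₀, ¬ DeviatesAt P alg alg' n

/-- `E[rew(n)]`: the Bayesian-expected reward collected at local step `n` (1-indexed)
by a stand-alone run of `alg`. -/
noncomputable def rewE (alg : Alg A) (n : ℕ) : ℝ :=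
  ∑' h : {h : History A // h.length + 1 = n},
    ∫ w, hProb alg w h.1 * ∑ a : A, ((alg h.1) a).toReal * w a ∂P

/-- `E[max_a μ_a]`: Bayesian-expected reward of the best arm. -/
noncomputable def optE : ℝ := ∫ w, ⨆ a : A, w a ∂P

/-- Bayesian instantaneous regret of `alg` at local step `n` (stand-alone run). -/
noncomputable def BIR (alg : Alg A) (n : ℕ) : ℝ := optE P - rewE P alg n

/-- `alg` is Bayesian-monotone: its Bayesian-expected reward is non-decreasing in `n`. -/
def BayesianMonotone (alg : Alg A) : Prop :=
  ∀ n m : ℕ, 1 ≤ n → n ≤ m → rewE P alg n ≤ rewE P alg m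

/- ### The competition game -/

/-- Bayesian-expected reward of the next local step of `alg`, when the joint
distribution over (mean vector, pair of local histories) has density `g` against `P`,
and `sel` extracts `alg`'s local history from the pair. -/
noncomputable def nextStepReward (alg : Alg A) (sel : History A × History A → History A)
    (g : (A → ℝ) → History A × History A → ℝ) : ℝ :=
  ∑' s : History A × History A, ∫ w, g w s * ∑ a : A, ((alg (sel s)) a).toReal * w a ∂P

/-- One global round of the game: the current agent chooses principal 1 with
probability `q`; the chosen principal's algorithm advances one local step. -/
noncomputable def stepDist (alg1 alg2 : Alg A) (q : ℝ)
    (g : (A → ℝ) → History A × History A → ℝ) :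
    (A → ℝ) → History A × History A → ℝ := fun w s =>
  (match s.1 with
   | [] => 0
   | (a, r) :: h1' =>
       q * g w (h1', s.2) * ((alg1 h1') a).toReal * (if r then w a else 1 - w a)) +
  (match s.2 with
   | [] => 0
   | (a, r) :: h2' =>
       (1 - q) * g w (s.1, h2') * ((alg2 h2') a).toReal * (if r then w a else 1 - w a))

/-- Joint distribution (density against the prior) over the pair of local histories
after `t` global rounds of the competition game, when the principals play
`(alg1, alg2)` and agents respond via `fresp`. -/
noncomputable def gameDist (alg1 alg2 : Alg A) (fresp : ℝ → ℝ) :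
    ℕ → (A → ℝ) → History A × History A → ℝ
  | 0 => fun _ s => if s = (([] : History A), ([] : History A)) then 1 else 0
  | t + 1 =>
      stepDist alg1 alg2
        (fresp (nextStepReward P alg1 Prod.fst (gameDist alg1 alg2 fresp t) -
                nextStepReward P alg2 Prod.snd (gameDist alg1 alg2 fresp t)))
        (gameDist alg1 alg2 fresp t)

/-- `PMR₁(t) = E[r_t | i_t = 1] = E[rew_1(n_1(t)+1)]`: posterior mean reward of
principal 1 at global round `t` (rounds are 1-indexed). -/
noncomputable def PMR1 (alg1 alg2 : Alg A) (fresp : ℝ → ℝ) (t : ℕ) : ℝ :=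
  nextStepReward P alg1 Prod.fst (gameDist P alg1 alg2 fresp (t - 1))

/-- `PMR₂(t)`: posterior mean reward of principal 2 at global round `t`. -/
noncomputable def PMR2 (alg1 alg2 : Alg A) (fresp : ℝ → ℝ) (t : ℕ) : ℝ :=
  nextStepReward P alg2 Prod.snd (gameDist P alg1 alg2 fresp (t - 1))

/-- Probability that agent `t` chooses principal 1:
`Pr[i_t = 1] = fresp (PMR₁(t) - PMR₂(t))`. -/
noncomputable def probChoose1 (alg1 alg2 : Alg A) (fresp : ℝ → ℝ) (t : ℕ) : ℝ :=
  fresp (PMR1 P alg1 alg2 fresp t - PMR2 P alg1 alg2 fresp t)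

/-- Expected number of the `T` agents that choose principal 1 (principal 1's utility). -/
noncomputable def marketShare1 (alg1 alg2 : Alg A) (fresp : ℝ → ℝ) (T : ℕ) : ℝ :=
  ∑ t ∈ Finset.Icc 1 T, probChoose1 P alg1 alg2 fresp t

/-- Expected number of the `T` agents that choose principal 2 (principal 2's utility). -/
noncomputable def marketShare2 (alg1 alg2 : Alg A) (fresp : ℝ → ℝ) (T : ℕ) : ℝ :=
  ∑ t ∈ Finset.Icc 1 T, (1 - probChoose1 P alg1 alg2 fresp t)

/-- `(a1, a2)` is a (pure) Nash equilibrium of the competition game with horizon `T`,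
response function `fresp`, and feasible strategy set `F`; each principal's utility
is the expected number of agents who choose her. -/
def IsNash (F : Set (Alg A)) (fresp : ℝ → ℝ) (T : ℕ) (a1 a2 : Alg A) : Prop :=
  a1 ∈ F ∧ a2 ∈ F ∧
  (∀ a1' ∈ F, marketShare1 P a1' a2 fresp T ≤ marketShare1 P a1 a2 fresp T) ∧
  (∀ a2' ∈ F, marketShare2 P a1 a2' fresp T ≤ marketShare2 P a1 a2 fresp T)

/- ### Response functions -/

/-- `HardMax` response function (its value at `0` — the tie-breaking rule —
is specified separately). -/
def IsHardMax (f : ℝ → ℝ) : Prop :=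
  (∀ x : ℝ, 0 < x → f x = 1) ∧ (∀ x : ℝ, x < 0 → f x = 0)

/-- `HardMax&Random` response function with baseline probability `ε₀ = f(-1)`. -/
def IsHardMaxRandom (f : ℝ → ℝ) (ε₀ : ℝ) : Prop :=
  ε₀ ∈ Set.Ioo (0:ℝ) (1/2 : ℝ) ∧ f (-1) = ε₀ ∧
  (∀ x : ℝ, 0 < x → f x = 1 - ε₀) ∧ (∀ x : ℝ, x < 0 → f x = ε₀)

/-- A symmetric response function: `f(x) + f(-x) = 1` for all `x ∈ [0,1]`. -/
def SymmetricResp (f : ℝ → ℝ) : Prop := ∀ x ∈ Set.Icc (0:ℝ) 1, f x + f (-x) = 1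

/-- `SoftMax` response function with smoothness constants `δ₀, c₀, c₀'`. -/
def IsSoftMax (f : ℝ → ℝ) (δ₀ c₀ c₀' : ℝ) : Prop :=
  (∃ ε ∈ Set.Ioo (0:ℝ) (1/2 : ℝ), ∀ x : ℝ, f x ∈ Set.Icc ε (1 - ε)) ∧
  f 0 = 1/2 ∧ 0 < δ₀ ∧ 0 < c₀ ∧ 0 < c₀' ∧
  ∀ x ∈ Set.Icc (-δ₀) δ₀, DifferentiableAt ℝ f x ∧ c₀ ≤ deriv f x ∧ deriv f x ≤ c₀'

/-- `alg1` BIR-dominates `alg2` starting from step `n₀`: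
`BIR₁(ε₀ n / 2) / BIR₂(n) < 1/2` for all `n ≥ n₀`. -/
def BIRDominates (alg1 alg2 : Alg A) (ε₀ : ℝ) (n₀ : ℕ) : Prop :=
  ∀ n : ℕ, n₀ ≤ n → BIR P alg1 ⌊ε₀ * n / 2⌋₊ / BIR P alg2 n < 1/2

/-- `alg1` weakly BIR-dominates `alg2` with constants `β₀, α₀ ∈ (0,1/2)`, from step `n₀`:
`BIR₁((1-β₀) n) / BIR₂(n) < 1 - α₀` for all `n ≥ n₀`. -/
def WeakBIRDominates (alg1 alg2 : Alg A) (β₀ α₀ : ℝ) (n₀ : ℕ) : Prop :=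
  ∀ n : ℕ, n₀ ≤ n → BIR P alg1 ⌊(1 - β₀) * n⌋₊ / BIR P alg2 n < 1 - α₀

end BayesianChoice

namespace BayesianChoice

open MeasureTheory

lemma pmf_sum_toReal {A : Type} [Fintype A] (p : PMF A) : ∑ a : A, (p a).toReal = 1 := by
  rw [← ENNReal.toReal_sum (fun a _ => p.apply_ne_top a), ← tsum_fintype (L := .unconditional A),
    p.tsum_coe]
  simp

noncomputable def hs (A : Type) [Fintype A] : ℕ → Finset (History A)
  | 0 => {[]}
  | t + 1 => ((Finset.univ : Finset (A × Bool)) ×ˢ hs A t).image (fun p => p.1 :: p.2)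

lemma mem_hs {A : Type} [Fintype A] (t : ℕ) (h : History A) : h ∈ hs A t ↔ h.length = t := by
  induction t generalizing h with
  | zero => simp [hs]
  | succ t ih =>
    cases h with
    | nil => simp [hs]
    | cons x h => simp [hs, ih]

lemma sum_hProb {A : Type} [Fintype A] (alg : Alg A) (w : A → ℝ) (t : ℕ) :
    ∑ h ∈ hs A t, hProb alg w h = 1 := by
  induction t with
  | zero => simp [hs, hProb]
  | succ t ih =>
    rw [hs, Finset.sum_image, Finset.sum_product_right, ← ih]
    · refine Finset.sum_congr rfl fun h _ => ?_
      rw [Fintype.sum_prod_type]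
      have : ∀ a : A, ∑ r : Bool, hProb alg w ((a, r) :: h) =
          hProb alg w h * ((alg h) a).toReal := by
        intro a
        simp [hProb]
        ring
      simp only [this]
      rw [← Finset.mul_sum, pmf_sum_toReal, mul_one]
    · rintro ⟨a, b⟩ _ ⟨c, d⟩ _ h
      simpa using h

lemma hProb_meas {A : Type} [Fintype A] (alg : Alg A) (h : History A) :
    Measurable (fun w => hProb alg w h) := by
  induction h with
  | nil => simp [hProb]
  | cons x h ih =>
    obtain ⟨a, r⟩ := x
    cases r
    · simp only [hProb]
      simp
      fun_prop
    · simp only [hProb]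
      simp
      fun_prop

lemma hProb_bdd {A : Type} [Fintype A] (alg : Alg A) (h : History A) (w : A → ℝ)
    (hw : ∀ a, w a ∈ Set.Icc (0:ℝ) 1) : |hProb alg w h| ≤ 1 := by
  induction h with
  | nil => simp [hProb]
  | cons x h ih =>
    obtain ⟨a, r⟩ := x
    simp only [hProb, abs_mul]
    have h1 : |((alg h) a).toReal| ≤ 1 := by
      rw [abs_of_nonneg ENNReal.toReal_nonneg]
      exact ENNReal.toReal_le_of_le_ofReal zero_le_one (by simpa using (alg h).coe_le_one a)
    have h2 : |(if r = true then w a else 1 - w a)| ≤ 1 := by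
      have := hw a
      rw [Set.mem_Icc] at this
      split_ifs <;> rw [abs_le] <;> constructor <;> linarith
    exact mul_le_one₀ (mul_le_one₀ ih (abs_nonneg _) h1) (abs_nonneg _) h2

lemma cube_ae {A : Type} [Fintype A] (P : Measure (A → ℝ)) [IsProbabilityMeasure P]
    (hcube : PriorOnUnitCube P) : ∀ᵐ w ∂P, ∀ a, w a ∈ Set.Icc (0:ℝ) 1 := by
  have hm : MeasurableSet {w : A → ℝ | ∀ a : A, w a ∈ Set.Icc (0:ℝ) 1} := by
    rw [Set.ofPred_forall]
    exact MeasurableSet.iInter fun a => measurable_pi_apply a measurableSet_Icc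
  exact (mem_ae_iff_prob_eq_one hm).2 hcube

lemma int_coord {A : Type} [Fintype A] (P : Measure (A → ℝ)) [IsProbabilityMeasure P]
    (hcube : PriorOnUnitCube P) (a : A) : Integrable (fun w => w a) P := by
  refine Integrable.of_bound (measurable_pi_apply a).aestronglyMeasurable 1 ?_
  filter_upwards [cube_ae P hcube] with w hw
  have := hw a
  rw [Real.norm_eq_abs, abs_of_nonneg this.1]
  exact this.2

lemma int_hProb_mul {A : Type} [Fintype A] (P : Measure (A → ℝ)) [IsProbabilityMeasure P]
    (hcube : PriorOnUnitCube P) (alg : Alg A) (h : History A) (φ : (A → ℝ) → ℝ)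
    (hφ : Integrable φ P) : Integrable (fun w => hProb alg w h * φ w) P := by
  refine hφ.bdd_mul (c := 1) (hProb_meas alg h).aestronglyMeasurable ?_
  filter_upwards [cube_ae P hcube] with w hw
  exact hProb_bdd alg h w hw

lemma int_mix {A : Type} [Fintype A] (P : Measure (A → ℝ)) [IsProbabilityMeasure P]
    (hcube : PriorOnUnitCube P) (p : PMF A) :
    Integrable (fun w => ∑ a : A, (p a).toReal * w a) P :=
  integrable_finsetSum _ fun a _ => (int_coord P hcube a).const_mul _

lemma nextStep_eq {A : Type} [Fintype A] (P : Measure (A → ℝ)) [IsProbabilityMeasure P]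
    (hcube : PriorOnUnitCube P) (alg1 alg : Alg A) (t : ℕ)
    (sel : History A × History A → History A) (p : PMF A)
    (hp : ∀ h, alg (sel (h, [])) = p)
    (g : (A → ℝ) → History A × History A → ℝ)
    (hg : ∀ w s, g w s = if s.2 = [] ∧ s.1.length = t then hProb alg1 w s.1 else 0) :
    nextStepReward P alg sel g = ∑ a : A, (p a).toReal * ∫ w, w a ∂P := by
  unfold nextStepReward
  rw [tsum_eq_sum (s := (hs A t).image fun h => (h, ([] : History A)))]
  · rw [Finset.sum_image (by rintro a _ b _ h; simpa using h)]
    have h1 : ∀ h ∈ hs A t, (∫ w, g w (h, []) * ∑ a : A, ((alg (sel (h, []))) a).toReal * w a ∂P)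
        = ∫ w, hProb alg1 w h * ∑ a : A, (p a).toReal * w a ∂P := by
      intro h hh
      rw [mem_hs] at hh
      simp [hg, hp, hh]
    rw [Finset.sum_congr rfl h1, ← integral_finsetSum]
    · simp_rw [← Finset.sum_mul, sum_hProb, one_mul]
      rw [integral_finsetSum _ fun a _ => (int_coord P hcube a).const_mul _]
      simp_rw [integral_const_mul]
    · intro h _
      exact int_hProb_mul P hcube alg1 h _ (int_mix P hcube p)
  · rintro ⟨h, h2⟩ hn
    have : ¬ (h2 = [] ∧ h.length = t) := by
      rintro ⟨rfl, hl⟩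
      exact hn (Finset.mem_image.2 ⟨h, (mem_hs t h).2 hl, rfl⟩)
    simp [hg, this]

lemma postMean_nil {A : Type} [Fintype A] (P : Measure (A → ℝ)) [IsProbabilityMeasure P]
    (a : A) : postMean P ([] : History A) a = ∫ w, w a ∂P := by
  simp [postMean, lik]

lemma fresp_one {A : Type} [Fintype A] [Nonempty A]
    (P : Measure (A → ℝ)) [IsProbabilityMeasure P]
    (hcube : PriorOnUnitCube P)
    (hdistinct : ∀ a a' : A, a ≠ a' →
      postMean P ([] : History A) a ≠ postMean P ([] : History A) a')
    (fresp : ℝ → ℝ) (hHM : IsHardMax fresp) (htie : fresp 0 = 1)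
    (alg1 alg2 : Alg A) (hSG : IsStaticGreedy P alg1) (t : ℕ)
    (g : (A → ℝ) → History A × History A → ℝ)
    (hg : ∀ w s, g w s = if s.2 = [] ∧ s.1.length = t then hProb alg1 w s.1 else 0) :
    fresp (nextStepReward P alg1 Prod.fst g - nextStepReward P alg2 Prod.snd g) = 1 := by
  obtain ⟨b, hb⟩ := (alg1 []).support_nonempty
  have hbm := hSG [] b hb
  have hsupp : ∀ h, (alg1 h).support = {b} := by
    intro h
    have hsub : (alg1 h).support ⊆ {b} := by
      intro a ha
      by_contra hne
      exact hdistinct a b hne (le_antisymm (hbm a) (hSG h a ha b))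
    exact (Set.subset_singleton_iff_eq.1 hsub).resolve_left (alg1 h).support_nonempty.ne_empty
  have hpure : ∀ h, alg1 h = PMF.pure b := by
    intro h
    have h1 := ((alg1 h).apply_eq_one_iff b).2 (hsupp h)
    ext a
    by_cases hab : a = b
    · subst hab; simp [h1]
    · rw [PMF.pure_apply_of_ne _ _ hab, PMF.apply_eq_zero_iff, hsupp h]
      simpa using hab
  rw [nextStep_eq P hcube alg1 alg1 t Prod.fst (PMF.pure b) (fun h => hpure h) g hg,
    nextStep_eq P hcube alg1 alg2 t Prod.snd (alg2 []) (fun h => rfl) g hg]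
  have e1 : ∑ a : A, ((PMF.pure b) a).toReal * ∫ w, w a ∂P = ∫ w, w b ∂P := by
    rw [Finset.sum_eq_single b]
    · simp
    · intro a _ hab
      rw [PMF.pure_apply_of_ne _ _ hab]; simp
    · simp
  have e2 : ∑ a : A, ((alg2 []) a).toReal * ∫ w, w a ∂P ≤ ∫ w, w b ∂P := by
    calc _ ≤ ∑ a : A, ((alg2 []) a).toReal * ∫ w, w b ∂P := by
          refine Finset.sum_le_sum fun a _ => mul_le_mul_of_nonneg_left ?_ ENNReal.toReal_nonneg
          have := hbm a
          rwa [postMean_nil, postMean_nil] at this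
      _ = _ := by rw [← Finset.sum_mul, pmf_sum_toReal, one_mul]
  rw [e1]
  rcases (sub_nonneg.2 e2).eq_or_lt with h | h
  · rw [← h]; exact htie
  · exact hHM.1 _ h

lemma game_eq {A : Type} [Fintype A] [Nonempty A]
    (P : Measure (A → ℝ)) [IsProbabilityMeasure P]
    (hcube : PriorOnUnitCube P)
    (hdistinct : ∀ a a' : A, a ≠ a' →
      postMean P ([] : History A) a ≠ postMean P ([] : History A) a')
    (fresp : ℝ → ℝ) (hHM : IsHardMax fresp) (htie : fresp 0 = 1)
    (alg1 alg2 : Alg A) (hSG : IsStaticGreedy P alg1) (t : ℕ) :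
    ∀ w s, gameDist P alg1 alg2 fresp t w s =
      if s.2 = [] ∧ s.1.length = t then hProb alg1 w s.1 else 0 := by
  induction t with
  | zero =>
    rintro w ⟨h1, h2⟩
    by_cases e1 : h1 = [] <;> by_cases e2 : h2 = [] <;> simp [gameDist, e1, e2, hProb]
  | succ t ih =>
    rintro w ⟨h1, h2⟩
    rw [gameDist, fresp_one P hcube hdistinct fresp hHM htie alg1 alg2 hSG t _ ih]
    rcases h1 with _ | ⟨⟨a, r⟩, h1⟩ <;> rcases h2 with _ | ⟨⟨a2, r2⟩, h2⟩ <;>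
      simp [stepDist, ih, hProb]
    split_ifs <;> rfl

/-- **Theorem (HardMax, deterministic tie-breaking for principal 1).**
Assume the `HardMax` response function with `fresp 0 = 1`, i.e. ties are always broken
in favor of principal 1.  If principal 1's algorithm is `StaticGreedy`, then all `T`
agents choose principal 1, regardless of principal 2's algorithm. -/
theorem hardMax_hardTies_staticGreedy_wins
    {A : Type} [Fintype A] [Nonempty A]
    (P : Measure (A → ℝ)) [IsProbabilityMeasure P]
    (hcube : PriorOnUnitCube P)
    (hdistinct : ∀ a a' : A, a ≠ a' →
      postMean P ([] : History A) a ≠ postMean P ([] : History A) a')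
    (fresp : ℝ → ℝ) (hHM : IsHardMax fresp) (htie : fresp 0 = 1)
    (alg1 alg2 : Alg A) (hSG : IsStaticGreedy P alg1) (T : ℕ) :
    ∀ t : ℕ, 1 ≤ t → t ≤ T → probChoose1 P alg1 alg2 fresp t = 1 := by
  intro t _ _
  exact fresp_one P hcube hdistinct fresp hHM htie alg1 alg2 hSG (t - 1) _
    (game_eq P hcube hdistinct fresp hHM htie alg1 alg2 hSG (t - 1))
end BayesianChoice
end

section
/- Consider a symmetric HardMax&Random response function f_resp with baseline probability ε_0 = f_resp(−1). Suppose ALG_1 is Bayesian-monotone and deviates from BayesGreedy starting from some local step n_0. Let ALG_2 be the greedy modification of ALG_1 with mixing parameter p > 0 such that (1 − ε_0)(1 − p) > ε_0. Then each agent t ≥ n_0 chooses principal 2 with probability 1 − ε_0, the largest possible probability for this response function. -/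
/-
A formalization of the Bayesian-choice model of competing bandits.

Two principals each commit to a multi-armed bandit algorithm over a finite set
`A` of arms with Bernoulli rewards.  The mean-reward vector `w : A → ℝ` is drawn
once from a common Bayesian prior `P`.  An algorithm is a map from (reversed)
histories of (arm, reward) pairs to distributions over arms.  Agents arrive
sequentially; agent `t` (rounds are 1-indexed) chooses principal 1 with
probability `fresp (PMR₁(t) - PMR₂(t))`, where `PMRᵢ(t)` is the Bayesian
posterior mean reward of principal `i`'s next local step; the chosen principal's
algorithm advances one local step.
-/

open MeasureTheory
open scoped Classical

namespace BayesianChoice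

/- ### The greedy modification of an algorithm -/

variable {A : Type} [Fintype A] [Nonempty A] (P : Measure (A → ℝ))

/-- An arm with the largest posterior mean reward given history `h`
(the "Bayesian-greedy choice" on the data `h`). -/
noncomputable def greedyArm (h : History A) : A :=
  Classical.choose
    (Finset.exists_max_image (Finset.univ : Finset A) (postMean P h) Finset.univ_nonempty)

/-- Stand-alone run of the greedy modification of `alg1` with mixing parameter `p`
(mixing is active from local step `n₀` on):  `gmDist alg1 p n₀ w n h` is the
probability, given mean vector `w`, that after `n` local steps the *recorded* history
(the data collected by the invocations of `alg1`, most recent first) equals `h`.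
In each step `n < n₀` it invokes `alg1` (which there coincides with `BayesGreedy`);
in each step `n ≥ n₀`, with probability `p` it makes the greedy choice (whose data is
not recorded), and with probability `1 - p` it invokes `alg1` and records the data. -/
noncomputable def gmDist (alg1 : Alg A) (p : ℝ) (n₀ : ℕ) (w : A → ℝ) :
    ℕ → History A → ℝ
  | 0, h => if h = [] then 1 else 0
  | n + 1, h =>
      (if n + 1 < n₀ then 0 else p * gmDist alg1 p n₀ w n h) +
      (if n + 1 < n₀ then 1 else 1 - p) *
        (match h with
         | [] => 0
         | (a, r) :: h' =>
             gmDist alg1 p n₀ w n h' * ((alg1 h') a).toReal * (if r then w a else 1 - w a))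

/-- Bayesian-expected reward collected at local step `n` (1-indexed) by a stand-alone
run of the greedy modification of `alg1` with mixing parameter `p` (mixing from `n₀`). -/
noncomputable def gmRewE (alg1 : Alg A) (p : ℝ) (n₀ n : ℕ) : ℝ :=
  ∑' h : History A,
    ∫ w, gmDist alg1 p n₀ w (n - 1) h *
      (if n < n₀ then ∑ a : A, ((alg1 h) a).toReal * w a
       else (1 - p) * ∑ a : A, ((alg1 h) a).toReal * w a + p * w (greedyArm P h)) ∂P

/-- Bayesian instantaneous regret of the greedy modification at local step `n`. -/
noncomputable def gmBIR (alg1 : Alg A) (p : ℝ) (n₀ n : ℕ) : ℝ :=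
  optE P - gmRewE P alg1 p n₀ n

/-- `Pr[M_n = m]`: probability that `alg1` is invoked exactly `m` times in the first
`n` steps of the greedy modification (equivalently, that the recorded history has
length `m` after `n` steps). -/
noncomputable def Mdist (alg1 : Alg A) (p : ℝ) (n₀ n m : ℕ) : ℝ :=
  ∑' h : {h : History A // h.length = m}, ∫ w, gmDist alg1 p n₀ w n h.1 ∂P

/-- `E[M_n]`: expected number of invocations of `alg1` in the first `n` steps. -/
noncomputable def Mmean (alg1 : Alg A) (p : ℝ) (n₀ n : ℕ) : ℝ :=
  ∑' m : ℕ, (m : ℝ) * Mdist P alg1 p n₀ n m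

/-- `BIR^gr(m)`: the Bayesian instantaneous regret of the hypothetical algorithm that
at each step `m` outputs the Bayesian-greedy choice based on the data collected by
`alg1` in its first `m - 1` steps. -/
noncomputable def BIRgr (alg1 : Alg A) (m : ℕ) : ℝ :=
  optE P - ∑' h : {h : History A // h.length + 1 = m},
    ∫ w, hProb alg1 w h.1 * w (greedyArm P h.1) ∂P

/-- `E[reg₂(n) | M_n = m]`: conditional expectation of the (frequentist) instantaneous
regret `reg₂(n) = max_a μ_a - rew₂(n)` of the greedy modification at step `n`,
given that `alg1` is invoked `m` times in the first `n` steps. -/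
noncomputable def condRegret (alg1 : Alg A) (p : ℝ) (n₀ n m : ℕ) : ℝ :=
  ((1 - p) * ∑' h : {h : History A // h.length + 1 = m},
      ∫ w, gmDist alg1 p n₀ w (n - 1) h.1 *
        ((⨆ a : A, w a) - ∑ a : A, ((alg1 h.1) a).toReal * w a) ∂P
   + p * ∑' h : {h : History A // h.length = m},
      ∫ w, gmDist alg1 p n₀ w (n - 1) h.1 *
        ((⨆ a : A, w a) - w (greedyArm P h.1)) ∂P)
  / Mdist P alg1 p n₀ n m

/- ### The competition game against the greedy modification -/

/-- Bayesian-expected reward of the next local step of the greedy modification,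
given its local state `s = (recorded history, number of local steps taken)`. -/
noncomputable def gmStepReward (alg1 : Alg A) (p : ℝ) (n₀ : ℕ) (w : A → ℝ)
    (s : History A × ℕ) : ℝ :=
  if s.2 + 1 < n₀ then ∑ a : A, ((alg1 s.1) a).toReal * w a
  else (1 - p) * ∑ a : A, ((alg1 s.1) a).toReal * w a + p * w (greedyArm P s.1)

/-- One global round of the competition game in which principal 1 plays `alg1` and
principal 2 plays the greedy modification of `alg1`; the agent chooses principal 1
with probability `q`.  The joint state records principal 1's local history and
principal 2's local state (recorded history, number of local steps taken). -/
noncomputable def gmGameStep (alg1 : Alg A) (p : ℝ) (n₀ : ℕ) (q : ℝ)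
    (g : (A → ℝ) → History A × (History A × ℕ) → ℝ) :
    (A → ℝ) → History A × (History A × ℕ) → ℝ := fun w s =>
  (match s.1 with
   | [] => 0
   | (a, r) :: h1' =>
       q * g w (h1', s.2) * ((alg1 h1') a).toReal * (if r then w a else 1 - w a)) +
  (match s.2.2 with
   | 0 => 0
   | n + 1 =>
     if n + 1 < n₀ then
       (match s.2.1 with
        | [] => 0
        | (a, r) :: h2' =>
            (1 - q) * g w (s.1, (h2', n)) * ((alg1 h2') a).toReal *
              (if r then w a else 1 - w a))
     else
       (1 - q) * p * g w (s.1, (s.2.1, n)) +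
       (match s.2.1 with
        | [] => 0
        | (a, r) :: h2' =>
            (1 - q) * (1 - p) * g w (s.1, (h2', n)) * ((alg1 h2') a).toReal *
              (if r then w a else 1 - w a)))

/-- Bayesian-expected reward of principal 1's next local step, given joint density `g`. -/
noncomputable def gmNext1 (alg1 : Alg A)
    (g : (A → ℝ) → History A × (History A × ℕ) → ℝ) : ℝ :=
  ∑' s : History A × (History A × ℕ),
    ∫ w, g w s * ∑ a : A, ((alg1 s.1) a).toReal * w a ∂P

/-- Bayesian-expected reward of principal 2's (the greedy modification's) next local
step, given joint density `g`. -/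
noncomputable def gmNext2 (alg1 : Alg A) (p : ℝ) (n₀ : ℕ)
    (g : (A → ℝ) → History A × (History A × ℕ) → ℝ) : ℝ :=
  ∑' s : History A × (History A × ℕ), ∫ w, g w s * gmStepReward P alg1 p n₀ w s.2 ∂P

/-- Joint state distribution after `t` global rounds when principal 1 plays `alg1`
and principal 2 plays the greedy modification of `alg1` (mixing parameter `p`,
mixing from step `n₀`), and agents respond via `fresp`. -/
noncomputable def gmGameDist (alg1 : Alg A) (p : ℝ) (n₀ : ℕ) (fresp : ℝ → ℝ) :
    ℕ → (A → ℝ) → History A × (History A × ℕ) → ℝ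
  | 0 => fun _ s => if s = (([] : History A), (([] : History A), 0)) then 1 else 0
  | t + 1 =>
      gmGameStep alg1 p n₀
        (fresp (gmNext1 P alg1 (gmGameDist alg1 p n₀ fresp t) -
                gmNext2 P alg1 p n₀ (gmGameDist alg1 p n₀ fresp t)))
        (gmGameDist alg1 p n₀ fresp t)

/-- Probability that agent `t` chooses principal 1, when principal 2 plays the greedy
modification of principal 1's algorithm `alg1`. -/
noncomputable def probChoose1GM (alg1 : Alg A) (p : ℝ) (n₀ : ℕ) (fresp : ℝ → ℝ)
    (t : ℕ) : ℝ :=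
  fresp (gmNext1 P alg1 (gmGameDist P alg1 p n₀ fresp (t - 1)) -
         gmNext2 P alg1 p n₀ (gmGameDist P alg1 p n₀ fresp (t - 1)))

end BayesianChoice

namespace BayesianChoice

open MeasureTheory

section Helpers

/-- weights of the joint local counters (steps of 1, recorded steps of 2, steps of 2). -/
noncomputable def cW (p : ℝ) (n₀ : ℕ) (q : ℕ → ℝ) : ℕ → ℕ → ℕ → ℕ → ℝ
  | 0, k, m, n => if k = 0 ∧ m = 0 ∧ n = 0 then 1 else 0
  | t + 1, k, m, n =>
    (match k with
     | 0 => 0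
     | k' + 1 => q t * cW p n₀ q t k' m n) +
    (match n with
     | 0 => 0
     | n' + 1 =>
       if n' + 1 < n₀ then
         (match m with
          | 0 => 0
          | m' + 1 => (1 - q t) * cW p n₀ q t k m' n')
       else
         (1 - q t) * p * cW p n₀ q t k m n' +
         (match m with
          | 0 => 0
          | m' + 1 => (1 - q t) * (1 - p) * cW p n₀ q t k m' n'))

theorem cW_succ (p : ℝ) (n₀ : ℕ) (q : ℕ → ℝ) (t k m n : ℕ) : cW p n₀ q (t + 1) k m n =
    (match k with
     | 0 => 0
     | k' + 1 => q t * cW p n₀ q t k' m n) +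
    (match n with
     | 0 => 0
     | n' + 1 =>
       if n' + 1 < n₀ then
         (match m with
          | 0 => 0
          | m' + 1 => (1 - q t) * cW p n₀ q t k m' n')
       else
         (1 - q t) * p * cW p n₀ q t k m n' +
         (match m with
          | 0 => 0
          | m' + 1 => (1 - q t) * (1 - p) * cW p n₀ q t k m' n')) := by
  rfl

theorem cW_supp (p : ℝ) (n₀ : ℕ) (q : ℕ → ℝ) (t : ℕ) :
    ∀ k m n, (t < k ∨ t < m ∨ t < n) → cW p n₀ q t k m n = 0 := by
  induction t with
  | zero =>
    intro k m n h
    rw [cW, if_neg]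
    omega
  | succ t ih =>
    intro k m n h
    have e1 : ∀ k', k = k' + 1 → cW p n₀ q t k' m n = 0 := fun k' hk => ih _ _ _ (by omega)
    have e2 : ∀ n', n = n' + 1 → t < k ∨ t < m ∨ t < n' := fun k' hk => by omega
    have e3 : ∀ n' m', n = n' + 1 → m = m' + 1 → t < k ∨ t < m' ∨ t < n' :=
      fun n' m' hk hm => by omega
    rw [cW_succ]
    rcases k with _ | k <;> rcases n with _ | n <;> rcases m with _ | m <;>
      simp_all

theorem cW_nonneg (p : ℝ) (n₀ : ℕ) (q : ℕ → ℝ) (hp0 : 0 < p) (hp1 : p < 1) (t : ℕ)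
    (hq : ∀ s < t, 0 < q s ∧ q s < 1) :
    ∀ k m n, 0 ≤ cW p n₀ q t k m n := by
  induction t with
  | zero =>
    intro k m n
    rw [cW]; split_ifs <;> norm_num
  | succ t ih =>
    intro k m n
    have ih := ih (fun s hs => hq s (by omega))
    obtain ⟨h1, h2⟩ := hq t (by omega)
    have h3 : 0 ≤ 1 - q t := by linarith
    have h4 : 0 ≤ 1 - p := by linarith
    have a1 : ∀ k m n, 0 ≤ q t * cW p n₀ q t k m n := fun k m n => mul_nonneg h1.le (ih _ _ _)
    have a2 : ∀ k m n, 0 ≤ (1 - q t) * cW p n₀ q t k m n := fun k m n => mul_nonneg h3 (ih _ _ _)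
    have a3 : ∀ k m n, 0 ≤ (1 - q t) * p * cW p n₀ q t k m n :=
      fun k m n => mul_nonneg (mul_nonneg h3 hp0.le) (ih _ _ _)
    have a4 : ∀ k m n, 0 ≤ (1 - q t) * (1 - p) * cW p n₀ q t k m n :=
      fun k m n => mul_nonneg (mul_nonneg h3 h4) (ih _ _ _)
    rw [cW_succ]
    apply add_nonneg
    · rcases k with _ | k
      · exact le_rfl
      · exact a1 _ _ _
    · rcases n with _ | n
      · exact le_rfl
      · dsimp only
        split_ifs
        · rcases m with _ | m
          · exact le_rfl
          · exact a2 _ _ _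
        · apply add_nonneg (a3 _ _ _)
          rcases m with _ | m
          · exact le_rfl
          · exact a4 _ _ _

/-- positive weight on the relevant state -/
theorem cW_pos (p : ℝ) (n₀ : ℕ) (q : ℕ → ℝ) (hp0 : 0 < p) (hp1 : p < 1) (N : ℕ)
    (hN : n₀ = N + 1) (t : ℕ)
    (hq : ∀ s < t, 0 < q s ∧ q s < 1) :
    ∃ k, 0 < cW p n₀ q t k (min t N) (min t N) := by
  induction t with
  | zero => exact ⟨0, by simp [cW]⟩
  | succ t ih =>
    obtain ⟨k, hk⟩ := ih (fun s hs => hq s (by omega))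
    have nn := cW_nonneg p n₀ q hp0 hp1 t (fun s hs => hq s (by omega))
    obtain ⟨h1, h2⟩ := hq t (by omega)
    have h3 : 0 < 1 - q t := by linarith
    have h4 : 0 ≤ 1 - p := by linarith
    by_cases htN : t + 1 ≤ N
    · refine ⟨k, ?_⟩
      rw [min_eq_left (by omega)] at hk
      rw [min_eq_left htN, cW_succ]
      dsimp only
      rw [if_pos (by omega)]
      have := mul_pos h3 hk
      rcases k with _ | k
      · simpa using this
      · have := mul_nonneg h1.le (nn k (t+1) (t+1))
        dsimp only
        linarith
    · refine ⟨k + 1, ?_⟩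
      rw [min_eq_right (by omega)] at hk ⊢
      rw [cW_succ]
      apply add_pos_of_pos_of_nonneg (mul_pos h1 hk)
      rcases N with _ | N
      · exact le_rfl
      · dsimp only
        rw [if_pos (by omega)]
        exact mul_nonneg h3.le (nn _ _ _)

/-- expectation over counters -/
noncomputable def Ev (N : ℕ) (c : ℕ → ℕ → ℕ → ℝ) (φ : ℕ → ℕ → ℕ → ℝ) : ℝ :=
  ∑ k ∈ Finset.range N, ∑ m ∈ Finset.range N, ∑ n ∈ Finset.range N, c k m n * φ k m n

theorem Ev_le {N : ℕ} {c φ ψ : ℕ → ℕ → ℕ → ℝ}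
    (h : ∀ k m n, c k m n * φ k m n ≤ c k m n * ψ k m n) : Ev N c φ ≤ Ev N c ψ := by
  unfold Ev
  exact Finset.sum_le_sum fun k _ => Finset.sum_le_sum fun m _ =>
    Finset.sum_le_sum fun n _ => h k m n

theorem Ev_congr {N : ℕ} {c φ ψ : ℕ → ℕ → ℕ → ℝ}
    (h : ∀ k m n, c k m n * φ k m n = c k m n * ψ k m n) : Ev N c φ = Ev N c ψ :=
  le_antisymm (Ev_le fun k m n => (h k m n).le) (Ev_le fun k m n => (h k m n).ge)

theorem Ev_add {N : ℕ} {c φ ψ : ℕ → ℕ → ℕ → ℝ} :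
    Ev N c (fun k m n => φ k m n + ψ k m n) = Ev N c φ + Ev N c ψ := by
  simp [Ev, mul_add, Finset.sum_add_distrib]

theorem shift_sum (N : ℕ) (f φ : ℕ → ℝ) (hf : ∀ k, N ≤ k + 1 → f k = 0) :
    ∑ k ∈ Finset.range N, (match k with | 0 => 0 | k' + 1 => f k') * φ k
      = ∑ k ∈ Finset.range N, f k * φ (k + 1) := by
  rcases N with _ | N
  · simp
  · rw [Finset.sum_range_succ', Finset.sum_range_succ, hf N le_rfl]
    simp

theorem sum_rot (N : ℕ) (F : ℕ → ℕ → ℕ → ℝ) :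
    ∑ k ∈ Finset.range N, ∑ m ∈ Finset.range N, ∑ n ∈ Finset.range N, F k m n =
    ∑ m ∈ Finset.range N, ∑ n ∈ Finset.range N, ∑ k ∈ Finset.range N, F k m n := by
  rw [Finset.sum_comm]
  exact Finset.sum_congr rfl fun m _ => Finset.sum_comm

theorem Ev_succ (p : ℝ) (n₀ : ℕ) (q : ℕ → ℝ) (t N : ℕ) (hN : t + 1 < N)
    (φ : ℕ → ℕ → ℕ → ℝ) :
    Ev N (cW p n₀ q (t + 1)) φ = Ev N (cW p n₀ q t) (fun k m n =>
      q t * φ (k + 1) m n + (1 - q t) * (if n + 1 < n₀ then φ k (m + 1) (n + 1)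
        else p * φ k m (n + 1) + (1 - p) * φ k (m + 1) (n + 1))) := by
  have hs := cW_supp p n₀ q t
  set c := cW p n₀ q t with hc
  have A1 : Ev N (fun k m n => (match k with
     | 0 => 0
     | k' + 1 => q t * c k' m n)) φ = Ev N c (fun k m n => q t * φ (k + 1) m n) := by
    unfold Ev
    refine (sum_rot _ _).trans (Eq.trans ?_ (sum_rot _ _).symm)
    refine Finset.sum_congr rfl fun m _ => ?_
    refine Finset.sum_congr rfl fun n _ => ?_
    rw [shift_sum N (fun k => q t * c k m n) (fun k => φ k m n)
      (fun k hk => by rw [hs k m n (by omega), mul_zero])]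
    exact Finset.sum_congr rfl fun k _ => by ring
  have A2 : Ev N (fun k m n => (match n with
     | 0 => 0
     | n' + 1 =>
       if n' + 1 < n₀ then
         (match m with
          | 0 => 0
          | m' + 1 => (1 - q t) * c k m' n')
       else
         (1 - q t) * p * c k m n' +
         (match m with
          | 0 => 0
          | m' + 1 => (1 - q t) * (1 - p) * c k m' n'))) φ
      = Ev N c (fun k m n => (1 - q t) * (if n + 1 < n₀ then φ k (m + 1) (n + 1)
        else p * φ k m (n + 1) + (1 - p) * φ k (m + 1) (n + 1))) := by
    unfold Ev
    refine Finset.sum_congr rfl fun k _ => ?_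
    have step : ∀ m, ∑ n ∈ Finset.range N, (match n with
     | 0 => 0
     | n' + 1 =>
       if n' + 1 < n₀ then
         (match m with
          | 0 => 0
          | m' + 1 => (1 - q t) * c k m' n')
       else
         (1 - q t) * p * c k m n' +
         (match m with
          | 0 => 0
          | m' + 1 => (1 - q t) * (1 - p) * c k m' n')) * φ k m n =
        ∑ n ∈ Finset.range N, (if n + 1 < n₀ then
         (match m with
          | 0 => 0
          | m' + 1 => (1 - q t) * c k m' n)
       else
         (1 - q t) * p * c k m n +
         (match m with
          | 0 => 0
          | m' + 1 => (1 - q t) * (1 - p) * c k m' n)) * φ k m (n + 1) := by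
      intro m
      apply shift_sum N (fun n => if n + 1 < n₀ then
         (match m with
          | 0 => 0
          | m' + 1 => (1 - q t) * c k m' n)
       else
         (1 - q t) * p * c k m n +
         (match m with
          | 0 => 0
          | m' + 1 => (1 - q t) * (1 - p) * c k m' n)) (fun n => φ k m n)
      intro n hn
      have : ∀ m, c k m n = 0 := fun m => hs _ _ _ (by omega)
      rcases m with _ | m <;> simp [this]
    simp only [step]
    rw [Finset.sum_comm]
    conv_rhs => rw [Finset.sum_comm]
    refine Finset.sum_congr rfl fun n _ => ?_
    by_cases hn : n + 1 < n₀
    · simp only [if_pos hn]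
      rw [shift_sum N (fun m => (1 - q t) * c k m n) (fun m => φ k m (n + 1))
        (fun m hm => by rw [hs k m n (by omega), mul_zero])]
      exact Finset.sum_congr rfl fun k _ => by ring
    · simp only [if_neg hn, add_mul]
      rw [Finset.sum_add_distrib,
        shift_sum N (fun m => (1 - q t) * (1 - p) * c k m n) (fun m => φ k m (n + 1))
        (fun m hm => by rw [hs k m n (by omega), mul_zero]),
        ← Finset.sum_add_distrib]
      exact Finset.sum_congr rfl fun k _ => by ring
  rw [Ev_add, ← A1, ← A2]
  unfold Ev
  simp only [← Finset.sum_add_distrib]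
  refine Finset.sum_congr rfl fun k _ => Finset.sum_congr rfl fun m _ =>
    Finset.sum_congr rfl fun n _ => ?_
  rw [cW_succ, add_mul]

theorem Ev_symm (p : ℝ) (n₀ : ℕ) (q : ℕ → ℝ) (N t : ℕ) (ht : t < n₀) (hN : t < N)
    (hq : ∀ s < t, q s = 1 / 2) (φ : ℕ → ℝ) :
    Ev N (cW p n₀ q t) (fun k _ _ => φ k) = Ev N (cW p n₀ q t) (fun _ m _ => φ m) := by
  induction t generalizing φ with
  | zero =>
    apply Ev_congr
    intro k m n
    rw [cW]
    split_ifs with h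
    · rw [h.1, h.2.1]
    · simp
  | succ t ih =>
    have hqt := hq t (by omega)
    rw [Ev_succ _ _ _ _ _ (by omega), Ev_succ _ _ _ _ _ (by omega)]
    have := ih (by omega) (by omega) (fun s hs => hq s (by omega))
      (fun k => 1 / 2 * φ (k + 1) + 1 / 2 * φ k)
    have e1 : Ev N (cW p n₀ q t) (fun k m n => q t * φ (k + 1) + (1 - q t) *
        (if n + 1 < n₀ then φ k else p * φ k + (1 - p) * φ k)) =
        Ev N (cW p n₀ q t) (fun k _ _ => 1 / 2 * φ (k + 1) + 1 / 2 * φ k) := by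
      apply Ev_congr
      intro k m n
      rw [hqt]
      split_ifs <;> ring
    rw [e1, this]
    apply Ev_congr
    intro k m n
    by_cases h : t < n
    · rw [cW_supp p n₀ q t k m n (by omega)]; simp
    · rw [if_pos (by omega), hqt]; ring

theorem Ev_dom (p : ℝ) (n₀ : ℕ) (q : ℕ → ℝ) (hp0 : 0 < p) (hp1 : p < 1) (N t : ℕ) (hN : t < N)
    (hq : ∀ s < t, 0 < q s ∧ q s < 1)
    (hq1 : ∀ s < t, s + 1 < n₀ → q s = 1 / 2)
    (hq2 : ∀ s < t, n₀ ≤ s + 1 → q s ≤ (1 - q s) * (1 - p)) (φ : ℕ → ℝ) (hφ : Monotone φ) :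
    Ev N (cW p n₀ q t) (fun k _ _ => φ k) ≤ Ev N (cW p n₀ q t) (fun _ m _ => φ m) := by
  induction t generalizing φ with
  | zero =>
    apply (Ev_congr _).le
    intro k m n
    rw [cW]
    split_ifs with h
    · rw [h.1, h.2.1]
    · simp
  | succ t ih =>
    obtain ⟨h1, h2⟩ := hq t (by omega)
    rw [Ev_succ _ _ _ _ _ (by omega), Ev_succ _ _ _ _ _ (by omega)]
    have := ih (by omega) (fun s hs => hq s (by omega)) (fun s hs => hq1 s (by omega))
      (fun s hs => hq2 s (by omega))
      (fun k => q t * φ (k + 1) + (1 - q t) * φ k) (by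
        intro a b hab
        have i1 := hφ hab
        have i2 : φ (a + 1) ≤ φ (b + 1) := hφ (by omega)
        have h3 : 0 ≤ 1 - q t := by linarith
        dsimp only
        gcongr)
    have e1 : Ev N (cW p n₀ q t) (fun k m n => q t * φ (k + 1) + (1 - q t) *
        (if n + 1 < n₀ then φ k else p * φ k + (1 - p) * φ k)) =
        Ev N (cW p n₀ q t) (fun k _ _ => q t * φ (k + 1) + (1 - q t) * φ k) := by
      apply Ev_congr
      intro k m n
      split_ifs <;> ring
    rw [e1]
    refine this.trans ?_
    apply Ev_le
    intro k m n
    have nn := cW_nonneg p n₀ q hp0 hp1 t (fun s hs => hq s (by omega)) k m n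
    by_cases h : t < n
    · rw [cW_supp p n₀ q t k m n (by omega)]; simp
    · apply mul_le_mul_of_nonneg_left _ nn
      have hm : φ m ≤ φ (m + 1) := hφ (by omega)
      by_cases h' : n₀ ≤ t + 1
      · have := hq2 t (by omega) h'
        have hp : 0 ≤ (φ (m + 1) - φ m) := by linarith
        split_ifs
        · nlinarith [mul_nonneg hp (sub_nonneg.2 this), mul_nonneg hp (mul_nonneg (sub_pos.2 h2).le hp0.le)]
        · nlinarith [mul_nonneg hp (sub_nonneg.2 this)]
      · rw [if_pos (by omega), hq1 t (by omega) (by omega)]; linarith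

variable {A : Type} [Fintype A] [Nonempty A]

/-- finset of all histories of a given length -/
noncomputable def LL (A : Type) [Fintype A] : ℕ → Finset (History A)
  | 0 => {[]}
  | k + 1 => ((Finset.univ : Finset (A × Bool)) ×ˢ LL A k).map
      ⟨fun x => x.1 :: x.2, fun x y h => by
        simp only [List.cons.injEq] at h
        exact Prod.ext h.1 h.2⟩

theorem mem_LL (k : ℕ) : ∀ h : History A, h ∈ LL A k ↔ h.length = k := by
  induction k with
  | zero => intro h; simp [LL]
  | succ k ih =>
    intro h
    rcases h with _ | ⟨x, h⟩
    · simp [LL]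
    · rw [LL, Finset.mem_map]
      constructor
      · rintro ⟨⟨y, g⟩, hg, he⟩
        change y :: g = x :: h at he
        simp only [List.cons.injEq] at he
        have := (ih g).1 (Finset.mem_product.1 hg).2
        rw [← he.2, List.length_cons, this]
      · intro hh
        exact ⟨(x, h), Finset.mem_product.2 ⟨Finset.mem_univ _, (ih h).2 (by simpa using hh)⟩, rfl⟩

theorem sum_LL_succ (k : ℕ) (F : History A → ℝ) :
    ∑ h ∈ LL A (k + 1), F h = ∑ h ∈ LL A k, ∑ x : A × Bool, F (x :: h) := by
  rw [LL, Finset.sum_map, Finset.sum_product, Finset.sum_comm]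
  rfl

theorem alg_sum (alg : Alg A) (h : History A) : ∑ a : A, ((alg h) a).toReal = 1 := by
  have h1 : ∑ a : A, (alg h) a = 1 := by
    rw [← tsum_fintype (L := SummationFilter.unconditional A)]; exact (alg h).tsum_coe
  rw [← ENNReal.toReal_sum (fun a _ => (alg h).apply_ne_top a), h1]
  simp

theorem hProb_sum (alg : Alg A) (w : A → ℝ) (k : ℕ) : ∑ h ∈ LL A k, hProb alg w h = 1 := by
  induction k with
  | zero => simp [LL, hProb]
  | succ k ih =>
    rw [sum_LL_succ, ← ih]
    refine Finset.sum_congr rfl fun h _ => ?_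
    rw [Fintype.sum_prod_type]
    simp only [Fintype.sum_bool, hProb, if_true, Bool.false_eq_true, if_false]
    calc _ = ∑ a : A, hProb alg w h * ((alg h) a).toReal :=
          Finset.sum_congr rfl fun a _ => by ring
      _ = _ := by rw [← Finset.mul_sum, alg_sum, mul_one]

theorem tsum_len (k : ℕ) (F : History A → ℝ) :
    ∑' h : {h : History A // h.length + 1 = k + 1}, F h.1 = ∑ h ∈ LL A k, F h := by
  have h1 := tsum_subtype {h : History A | h.length + 1 = k + 1} F
  refine h1.trans ?_
  rw [tsum_eq_sum (s := LL A k)]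
  · refine Finset.sum_congr rfl fun h hh => ?_
    rw [mem_LL] at hh
    simp [Set.indicator, hh]
  · intro h hh
    rw [mem_LL] at hh
    simp [Set.indicator, hh]

variable (P : Measure (A → ℝ))

/-- probability that agent `t+1` chooses principal 1 -/
noncomputable def qq (alg1 : Alg A) (p : ℝ) (n₀ : ℕ) (fresp : ℝ → ℝ) (t : ℕ) : ℝ :=
  fresp (gmNext1 P alg1 (gmGameDist P alg1 p n₀ fresp t) -
                gmNext2 P alg1 p n₀ (gmGameDist P alg1 p n₀ fresp t))

theorem gm_eq (alg1 : Alg A) (p : ℝ) (n₀ : ℕ) (fresp : ℝ → ℝ) (t : ℕ) :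
    ∀ (w : A → ℝ) (h1 h2 : History A) (n : ℕ),
    gmGameDist P alg1 p n₀ fresp t w (h1, (h2, n)) =
      cW p n₀ (qq P alg1 p n₀ fresp) t h1.length h2.length n *
        (hProb alg1 w h1 * hProb alg1 w h2) := by
  induction t with
  | zero =>
    intro w h1 h2 n
    rw [gmGameDist, cW]
    rcases h1 with _ | ⟨x, h1⟩ <;> rcases h2 with _ | ⟨y, h2⟩ <;> rcases n with _ | n <;>
      simp [hProb]
  | succ t ih =>
    intro w h1 h2 n
    rw [gmGameDist, cW_succ]
    change gmGameStep alg1 p n₀ (qq P alg1 p n₀ fresp t) _ w (h1, h2, n) = _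
    unfold gmGameStep
    rcases h1 with _ | ⟨⟨a, r⟩, h1⟩ <;> rcases h2 with _ | ⟨⟨b, r'⟩, h2⟩ <;> rcases n with _ | n <;>
      simp only [hProb, ih, List.length_nil, List.length_cons] <;> (try split_ifs) <;> ring

theorem gm_tsum (alg1 : Alg A) (p : ℝ) (n₀ : ℕ) (fresp : ℝ → ℝ) (t N : ℕ) (hN : t < N)
    (V : (A → ℝ) → History A × (History A × ℕ) → ℝ) :
    ∑' s : History A × (History A × ℕ), ∫ w, gmGameDist P alg1 p n₀ fresp t w s * V w s ∂P =
    ∑ k ∈ Finset.range N, ∑ m ∈ Finset.range N, ∑ n ∈ Finset.range N,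
      cW p n₀ (qq P alg1 p n₀ fresp) t k m n *
      ∑ h1 ∈ LL A k, ∑ h2 ∈ LL A m,
        ∫ w, (hProb alg1 w h1 * hProb alg1 w h2) * V w (h1, (h2, n)) ∂P := by
  have hd : Set.PairwiseDisjoint (Finset.range N : Set ℕ) (LL A) := by
    intro i _ j _ hij
    rw [Function.onFun, Finset.disjoint_left]
    intro h hi hj
    rw [mem_LL] at hi hj
    omega
  rw [tsum_eq_sum (s := ((Finset.range N).biUnion (LL A)) ×ˢ
    (((Finset.range N).biUnion (LL A)) ×ˢ Finset.range N))]
  · rw [Finset.sum_product, Finset.sum_biUnion hd]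
    refine Finset.sum_congr rfl fun k _ => ?_
    simp only [Finset.mul_sum]
    simp_rw [Finset.sum_product, Finset.sum_biUnion hd]
    rw [Finset.sum_comm]
    refine Finset.sum_congr rfl fun m _ => ?_
    rw [Finset.sum_comm' (s := Finset.range N) (t := fun _ => LL A k) (t' := LL A k)
      (s' := fun _ => Finset.range N) (by simp [and_comm])]
    refine Finset.sum_congr rfl fun h1 hh1 => ?_
    rw [Finset.sum_comm]
    refine Finset.sum_congr rfl fun n _ => ?_
    refine Finset.sum_congr rfl fun h2 hh2 => ?_
    rw [mem_LL] at hh1 hh2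
    rw [← integral_const_mul]
    congr 1
    funext w
    rw [gm_eq, hh1, hh2, mul_assoc]
  · rintro ⟨h1, h2, n⟩ hs
    have : cW p n₀ (qq P alg1 p n₀ fresp) t h1.length h2.length n = 0 := by
      apply cW_supp
      by_contra hcon
      apply hs
      simp only [Finset.mem_product, Finset.mem_biUnion, mem_LL, Finset.mem_range]
      exact ⟨⟨h1.length, by omega, rfl⟩, ⟨h2.length, by omega, rfl⟩, by omega⟩
    simp [gm_eq, this]

theorem int_cont [IsProbabilityMeasure P] (hcube : PriorOnUnitCube P) (f : (A → ℝ) → ℝ)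
    (hf : Continuous f) : Integrable f P := by
  have hset : {w : A → ℝ | ∀ a : A, w a ∈ Set.Icc (0:ℝ) 1} =
      Set.pi Set.univ (fun _ : A => Set.Icc (0:ℝ) 1) := by
    ext w; simp only [Set.mem_pi, Set.mem_setOf_eq, Set.mem_univ, true_implies]
  have hc : IsCompact {w : A → ℝ | ∀ a : A, w a ∈ Set.Icc (0:ℝ) 1} := by
    rw [hset]; exact isCompact_univ_pi fun _ => isCompact_Icc
  have hm := hc.measurableSet
  have hae : ∀ᵐ w ∂P, w ∈ {w : A → ℝ | ∀ a : A, w a ∈ Set.Icc (0:ℝ) 1} :=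
    (prob_compl_eq_zero_iff hm).2 hcube
  have hr : P.restrict {w : A → ℝ | ∀ a : A, w a ∈ Set.Icc (0:ℝ) 1} = P :=
    Measure.restrict_eq_self_of_ae_mem hae
  have := hf.continuousOn.integrableOn_compact (μ := P) hc
  rwa [IntegrableOn, hr] at this

theorem ae_cube [IsProbabilityMeasure P] (hcube : PriorOnUnitCube P) :
    ∀ᵐ w ∂P, ∀ a : A, w a ∈ Set.Icc (0:ℝ) 1 := by
  have hset : {w : A → ℝ | ∀ a : A, w a ∈ Set.Icc (0:ℝ) 1} =
      Set.pi Set.univ (fun _ : A => Set.Icc (0:ℝ) 1) := by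
    ext w; simp only [Set.mem_pi, Set.mem_setOf_eq, Set.mem_univ, true_implies]
  have hm : MeasurableSet {w : A → ℝ | ∀ a : A, w a ∈ Set.Icc (0:ℝ) 1} := by
    rw [hset]; exact (isCompact_univ_pi fun _ => isCompact_Icc).measurableSet
  exact (prob_compl_eq_zero_iff hm).2 hcube

/-- algorithmic part of the history probability -/
noncomputable def pa (alg : Alg A) : History A → ℝ
  | [] => 1
  | (a, _) :: h => pa alg h * ((alg h) a).toReal

theorem hProb_eq (alg : Alg A) (w : A → ℝ) (h : History A) :
    hProb alg w h = pa alg h * lik w h := by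
  induction h with
  | nil => simp [hProb, pa, lik]
  | cons x h ih =>
    obtain ⟨a, r⟩ := x
    rw [hProb, pa, lik, ih]; ring

theorem pa_nonneg (alg : Alg A) (h : History A) : 0 ≤ pa alg h := by
  induction h with
  | nil => simp [pa]
  | cons x h ih =>
    obtain ⟨a, r⟩ := x
    exact mul_nonneg ih ENNReal.toReal_nonneg

theorem lik_cont (h : History A) : Continuous (fun w : A → ℝ => lik w h) := by
  induction h with
  | nil => simp only [lik]; fun_prop
  | cons x h ih =>
    obtain ⟨a, r⟩ := x
    cases r <;> simp only [lik, if_true, Bool.false_eq_true, if_false] <;> fun_prop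

theorem hProb_cont (alg : Alg A) (h : History A) : Continuous (fun w : A → ℝ => hProb alg w h) := by
  simp only [hProb_eq]
  have := lik_cont h
  fun_prop

theorem lik_nonneg (w : A → ℝ) (hw : ∀ a : A, w a ∈ Set.Icc (0:ℝ) 1) (h : History A) :
    0 ≤ lik w h := by
  induction h with
  | nil => simp [lik]
  | cons x h ih =>
    obtain ⟨a, r⟩ := x
    have := hw a
    apply mul_nonneg ih
    split_ifs
    · exact this.1
    · linarith [this.2]

theorem greedy_max (h : History A) (a : A) : postMean P h a ≤ postMean P h (greedyArm P h) :=
  (Classical.choose_spec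
    (Finset.exists_max_image (Finset.univ : Finset A) (postMean P h) Finset.univ_nonempty)).2 a
    (Finset.mem_univ a)

theorem greedy_int [IsProbabilityMeasure P] (hcube : PriorOnUnitCube P) (h : History A) (a : A) :
    ∫ w, w a * lik w h ∂P ≤ ∫ w, w (greedyArm P h) * lik w h ∂P := by
  have hnn : 0 ≤ᵐ[P] fun w => lik w h := (ae_cube P hcube).mono fun w hw => lik_nonneg w hw h
  have hi := int_cont P hcube _ (lik_cont h)
  rcases (integral_nonneg_of_ae hnn).eq_or_lt with h0 | h0
  · have hz := (integral_eq_zero_iff_of_nonneg_ae hnn hi).1 h0.symm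
    have : ∀ b : A, ∫ w, w b * lik w h ∂P = 0 := by
      intro b
      rw [integral_eq_zero_of_ae]
      filter_upwards [hz] with w hw
      simp only [Pi.zero_apply] at hw ⊢
      rw [hw, mul_zero]
    rw [this, this]
  · have := greedy_max P h a
    unfold postMean at this
    exact (div_le_div_iff_of_pos_right h0).1 this

/-- expected reward of the next step after `k` steps, as a finite sum -/
noncomputable def RR (alg : Alg A) (k : ℕ) : ℝ :=
  ∑ h ∈ LL A k, ∫ w, hProb alg w h * ∑ a : A, ((alg h) a).toReal * w a ∂P

/-- expected greedy reward after `k` recorded steps -/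
noncomputable def GG (alg : Alg A) (k : ℕ) : ℝ :=
  ∑ h ∈ LL A k, ∫ w, hProb alg w h * w (greedyArm P h) ∂P

theorem rewE_eq (alg : Alg A) (k : ℕ) : rewE P alg (k + 1) = RR P alg k :=
  tsum_len k (fun h => ∫ w, hProb alg w h * ∑ a : A, ((alg h) a).toReal * w a ∂P)

theorem R_term [IsProbabilityMeasure P] (hcube : PriorOnUnitCube P) (alg : Alg A) (h : History A) :
    ∫ w, hProb alg w h * ∑ a : A, ((alg h) a).toReal * w a ∂P =
      pa alg h * ∑ a : A, ((alg h) a).toReal * ∫ w, w a * lik w h ∂P := by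
  have hl := lik_cont h
  have e : ∀ w : A → ℝ, hProb alg w h * ∑ a : A, ((alg h) a).toReal * w a =
      pa alg h * ∑ a : A, ((alg h) a).toReal * (w a * lik w h) := by
    intro w
    rw [hProb_eq, mul_assoc, Finset.mul_sum]
    congr 1
    exact Finset.sum_congr rfl fun a _ => by ring
  simp_rw [e]
  rw [integral_const_mul, integral_finsetSum]
  · simp_rw [integral_const_mul]
  · intro a _
    exact int_cont P hcube _ (by fun_prop)

theorem G_term (alg : Alg A) (h : History A) :
    ∫ w, hProb alg w h * w (greedyArm P h) ∂P =
      pa alg h * ∫ w, w (greedyArm P h) * lik w h ∂P := by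
  rw [← integral_const_mul]
  congr 1
  funext w
  rw [hProb_eq]; ring

theorem term_le [IsProbabilityMeasure P] (hcube : PriorOnUnitCube P) (alg : Alg A) (h : History A) :
    ∫ w, hProb alg w h * ∑ a : A, ((alg h) a).toReal * w a ∂P ≤
    ∫ w, hProb alg w h * w (greedyArm P h) ∂P := by
  rw [R_term P hcube, G_term]
  apply mul_le_mul_of_nonneg_left _ (pa_nonneg alg h)
  calc _ ≤ ∑ a : A, ((alg h) a).toReal * ∫ w, w (greedyArm P h) * lik w h ∂P :=
        Finset.sum_le_sum fun a _ =>
          mul_le_mul_of_nonneg_left (greedy_int P hcube h a) ENNReal.toReal_nonneg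
    _ = _ := by rw [← Finset.sum_mul, alg_sum, one_mul]

theorem term_lt [IsProbabilityMeasure P] (hcube : PriorOnUnitCube P)
    (hdistinct : DistinctPosteriorMeans P) (alg bg : Alg A)
    (hbg : IsBayesGreedy P bg) (h : History A) (hpos : 0 < prH P alg h) (hne : alg h ≠ bg h) :
    ∫ w, hProb alg w h * ∑ a : A, ((alg h) a).toReal * w a ∂P <
    ∫ w, hProb alg w h * w (greedyArm P h) ∂P := by
  have hnn : 0 ≤ᵐ[P] fun w => lik w h := (ae_cube P hcube).mono fun w hw => lik_nonneg w hw h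
  have hL := integral_nonneg_of_ae hnn
  have hp : 0 < pa alg h * ∫ w, lik w h ∂P := by
    rw [← integral_const_mul]
    simpa only [prH, hProb_eq] using hpos
  have hpa : 0 < pa alg h := pos_of_mul_pos_left hp hL
  have hfeas : 0 < ∫ w, lik w h ∂P := pos_of_mul_pos_right hp (pa_nonneg alg h)
  have hstrict : ∀ a, a ≠ greedyArm P h →
      ∫ w, w a * lik w h ∂P < ∫ w, w (greedyArm P h) * lik w h ∂P := by
    intro a ha
    have h1 := lt_of_le_of_ne (greedy_max P h a) (hdistinct h hfeas _ _ ha)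
    unfold postMean at h1
    exact (div_lt_div_iff_of_pos_right hfeas).1 h1
  have hpure : ∀ μ : PMF A, (∀ a ∈ μ.support, a = greedyArm P h) → μ = PMF.pure (greedyArm P h) := by
    intro μ hμ
    have hz : ∀ a, a ≠ greedyArm P h → μ a = 0 := by
      intro a ha
      by_contra hc
      exact ha (hμ a ((PMF.mem_support_iff _ _).2 hc))
    ext a
    rw [PMF.pure_apply]
    split_ifs with hh
    · have := μ.tsum_coe
      rw [tsum_eq_single (greedyArm P h) hz] at this
      rw [hh]; exact this
    · exact hz a hh
  have hb : bg h = PMF.pure (greedyArm P h) := by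
    apply hpure
    intro a ha
    by_contra hc
    exact hdistinct h hfeas _ _ hc (le_antisymm (greedy_max P h a) (hbg h hfeas a ha _))
  obtain ⟨a, ha, hag⟩ : ∃ a ∈ (alg h).support, a ≠ greedyArm P h := by
    by_contra! hcon
    exact hne ((hpure _ hcon).trans hb.symm)
  have hapos : 0 < ((alg h) a).toReal :=
    ENNReal.toReal_pos ((PMF.mem_support_iff _ _).1 ha) ((alg h).apply_ne_top a)
  rw [R_term P hcube, G_term]
  apply mul_lt_mul_of_pos_left _ hpa
  calc _ < ∑ a : A, ((alg h) a).toReal * ∫ w, w (greedyArm P h) * lik w h ∂P := by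
        apply Finset.sum_lt_sum
        · exact fun a _ =>
            mul_le_mul_of_nonneg_left (greedy_int P hcube h a) ENNReal.toReal_nonneg
        · exact ⟨a, Finset.mem_univ a, mul_lt_mul_of_pos_left (hstrict a hag) hapos⟩
    _ = _ := by rw [← Finset.sum_mul, alg_sum, one_mul]

theorem R_le_G [IsProbabilityMeasure P] (hcube : PriorOnUnitCube P) (alg : Alg A) (k : ℕ) :
    RR P alg k ≤ GG P alg k :=
  Finset.sum_le_sum fun h _ => term_le P hcube alg h

theorem int_sum2 [IsProbabilityMeasure P] (hcube : PriorOnUnitCube P) (alg : Alg A) (m : ℕ)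
    (f : (A → ℝ) → ℝ) (hf : Continuous f) :
    ∑ h2 ∈ LL A m, ∫ w, hProb alg w h2 * f w ∂P = ∫ w, f w ∂P := by
  rw [← integral_finsetSum]
  · congr 1
    funext w
    rw [← Finset.sum_mul, hProb_sum, one_mul]
  · intro h _
    have := hProb_cont alg h
    exact int_cont P hcube _ (by fun_prop)

theorem next1_eq [IsProbabilityMeasure P] (hcube : PriorOnUnitCube P)
    (alg1 : Alg A) (p : ℝ) (n₀ : ℕ) (fresp : ℝ → ℝ) (t N : ℕ) (hN : t < N) :
    gmNext1 P alg1 (gmGameDist P alg1 p n₀ fresp t) =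
      Ev N (cW p n₀ (qq P alg1 p n₀ fresp) t) (fun k _ _ => RR P alg1 k) := by
  unfold gmNext1
  rw [gm_tsum P alg1 p n₀ fresp t N hN
    (fun w s => ∑ a : A, ((alg1 s.1) a).toReal * w a)]
  unfold Ev
  refine Finset.sum_congr rfl fun k _ => Finset.sum_congr rfl fun m _ =>
    Finset.sum_congr rfl fun n _ => ?_
  congr 1
  refine Finset.sum_congr rfl fun h1 _ => ?_
  have := hProb_cont alg1 h1
  rw [← int_sum2 P hcube alg1 m _ (by fun_prop)]
  refine Finset.sum_congr rfl fun h2 _ => ?_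
  congr 1
  funext w
  ring

theorem next2_eq [IsProbabilityMeasure P] (hcube : PriorOnUnitCube P)
    (alg1 : Alg A) (p : ℝ) (n₀ : ℕ) (fresp : ℝ → ℝ) (t N : ℕ) (hN : t < N) :
    gmNext2 P alg1 p n₀ (gmGameDist P alg1 p n₀ fresp t) =
      Ev N (cW p n₀ (qq P alg1 p n₀ fresp) t) (fun _ m n => RR P alg1 m +
        (if n + 1 < n₀ then 0 else p * (GG P alg1 m - RR P alg1 m))) := by
  unfold gmNext2
  rw [gm_tsum P alg1 p n₀ fresp t N hN]
  unfold Ev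
  refine Finset.sum_congr rfl fun k _ => Finset.sum_congr rfl fun m _ =>
    Finset.sum_congr rfl fun n _ => ?_
  congr 1
  rw [Finset.sum_comm]
  unfold gmStepReward RR GG
  by_cases hn : n + 1 < n₀
  · simp only [if_pos hn, add_zero]
    refine Finset.sum_congr rfl fun h2 _ => ?_
    have := hProb_cont alg1 h2
    rw [← int_sum2 P hcube alg1 k _ (by fun_prop)]
    refine Finset.sum_congr rfl fun h2 _ => ?_
    congr 1
    funext w
    ring
  · simp only [if_neg hn]
    rw [← Finset.sum_sub_distrib, Finset.mul_sum, ← Finset.sum_add_distrib]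
    refine Finset.sum_congr rfl fun h2 _ => ?_
    have := hProb_cont alg1 h2
    have i1 : Integrable (fun w : A → ℝ => hProb alg1 w h2 *
      ∑ a : A, ((alg1 h2) a).toReal * w a) P := int_cont P hcube _ (by fun_prop)
    have i2 : Integrable (fun w : A → ℝ => hProb alg1 w h2 * w (greedyArm P h2)) P :=
      int_cont P hcube _ (by fun_prop)
    have i3 : Integrable (fun w : A → ℝ => p * (hProb alg1 w h2 * w (greedyArm P h2) -
      hProb alg1 w h2 * ∑ a : A, ((alg1 h2) a).toReal * w a)) P :=
      int_cont P hcube _ (by fun_prop)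
    rw [← integral_sub i2 i1, ← integral_const_mul, ← integral_add i1 i3,
      ← int_sum2 P hcube alg1 k _ (by fun_prop)]
    refine Finset.sum_congr rfl fun h2 _ => ?_
    congr 1
    funext w
    ring

end Helpers

/-- **Theorem (a little greedy goes a long way).**
Consider a symmetric `HardMax&Random` response function `fresp` with baseline
probability `ε₀ = fresp (-1)`.  Suppose `alg1` is Bayesian-monotone and deviates from
`BayesGreedy` starting from some local step `n₀`.  Let principal 2 play the greedy
modification of `alg1` with mixing parameter `p > 0` such that
`(1 - ε₀) (1 - p) > ε₀`.  Then each agent `t ≥ n₀` chooses principal 2 with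
probability `1 - ε₀` (the largest possible probability). -/
theorem greedy_modification_wins
    {A : Type} [Fintype A] [Nonempty A]
    (P : Measure (A → ℝ)) [IsProbabilityMeasure P]
    (hcube : PriorOnUnitCube P)
    (hbest : EachArmCanBeBest P)
    (hdistinct : DistinctPosteriorMeans P)
    (fresp : ℝ → ℝ) (ε₀ : ℝ) (hresp : IsHardMaxRandom fresp ε₀)
    (hsym : SymmetricResp fresp)
    (alg1 : Alg A) (hmono : BayesianMonotone P alg1)
    (bg : Alg A) (hbg : IsBayesGreedy P bg)
    (n₀ : ℕ) (hdev : DeviatesFrom P alg1 bg n₀)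
    (p : ℝ) (hp0 : 0 < p) (hp1 : p < 1) (hmix : ε₀ < (1 - ε₀) * (1 - p))
    (T : ℕ) :
    ∀ t : ℕ, n₀ ≤ t → t ≤ T →
      1 - probChoose1GM P alg1 p n₀ fresp t = 1 - ε₀ := by
  obtain ⟨⟨hε0, hε1⟩, -, hfpos, hfneg⟩ := hresp
  have hf0 : fresp 0 = 1 / 2 := by
    have := hsym 0 (by simp)
    rw [neg_zero] at this
    linarith
  obtain ⟨⟨H, hlen, ⟨h, hH, hpos⟩, -, hdiff⟩, -⟩ := hdev
  have hn₀ : n₀ = h.length + 1 := (hlen h hH).symm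
  set M := h.length with hM
  have hRmono : Monotone (RR P alg1) := by
    intro a b hab
    rw [← rewE_eq, ← rewE_eq]
    exact hmono _ _ (by omega) (by omega)
  have hGR : RR P alg1 M < GG P alg1 M := by
    apply Finset.sum_lt_sum
    · exact fun h _ => term_le P hcube alg1 h
    · exact ⟨h, (mem_LL _ _).2 rfl,
        term_lt P hcube hdistinct alg1 bg hbg h hpos (hdiff h hH)⟩
  have key : ∀ t, qq P alg1 p n₀ fresp t = if t + 1 < n₀ then 1 / 2 else ε₀ := by
    intro t
    induction t using Nat.strong_induction_on with
    | _ t ih =>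
    have hq : ∀ s < t, 0 < qq P alg1 p n₀ fresp s ∧ qq P alg1 p n₀ fresp s < 1 := by
      intro s hs
      rw [ih s hs]
      split_ifs
      · norm_num
      · exact ⟨hε0, by linarith⟩
    have hq1 : ∀ s < t, s + 1 < n₀ → qq P alg1 p n₀ fresp s = 1 / 2 := by
      intro s hs h1
      rw [ih s hs, if_pos h1]
    have e1 := next1_eq P hcube alg1 p n₀ fresp t (t + 1) (by omega)
    have e2 := next2_eq P hcube alg1 p n₀ fresp t (t + 1) (by omega)
    rw [Ev_add] at e2
    by_cases ht : t + 1 < n₀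
    · rw [if_pos ht, qq, ← hf0]
      congr 1
      have hz : Ev (t + 1) (cW p n₀ (qq P alg1 p n₀ fresp) t)
          (fun _ m n => if n + 1 < n₀ then 0 else p * (GG P alg1 m - RR P alg1 m)) =
          Ev (t + 1) (cW p n₀ (qq P alg1 p n₀ fresp) t) (fun _ _ _ => 0) := by
        apply Ev_congr
        intro k m n
        by_cases hn : t < n
        · rw [cW_supp _ _ _ _ _ _ _ (by omega)]; simp
        · rw [if_pos (by omega)]
      have hz0 : Ev (t + 1) (cW p n₀ (qq P alg1 p n₀ fresp) t) (fun _ _ _ => 0) = 0 := by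
        simp [Ev]
      rw [e1, e2, hz, hz0, Ev_symm p n₀ _ (t + 1) t (by omega) (by omega)
        (fun s hs => hq1 s hs (by omega))]
      ring
    · rw [if_neg ht, qq]
      apply hfneg
      have hdom := Ev_dom p n₀ (qq P alg1 p n₀ fresp) hp0 hp1 (t + 1) t (by omega) hq hq1
        (fun s hs h1 => by
          rw [ih s hs, if_neg (by omega)]; exact hmix.le) _ hRmono
      have nn := cW_nonneg p n₀ (qq P alg1 p n₀ fresp) hp0 hp1 t hq
      obtain ⟨k, hk⟩ := cW_pos p n₀ (qq P alg1 p n₀ fresp) hp0 hp1 M hn₀ t hq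
      rw [min_eq_right (by omega)] at hk
      have hkt : k ≤ t := by
        by_contra hc
        rw [cW_supp _ _ _ _ _ _ _ (by omega)] at hk
        exact lt_irrefl _ hk
      have tn : ∀ k m n, 0 ≤ cW p n₀ (qq P alg1 p n₀ fresp) t k m n *
          (if n + 1 < n₀ then 0 else p * (GG P alg1 m - RR P alg1 m)) := by
        intro k m n
        apply mul_nonneg (nn _ _ _)
        split_ifs
        · exact le_rfl
        · exact mul_nonneg hp0.le (sub_nonneg.2 (R_le_G P hcube alg1 m))
      have hgain : 0 < Ev (t + 1) (cW p n₀ (qq P alg1 p n₀ fresp) t)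
          (fun _ m n => if n + 1 < n₀ then 0 else p * (GG P alg1 m - RR P alg1 m)) := by
        unfold Ev
        refine Finset.sum_pos' (fun k _ => Finset.sum_nonneg fun m _ =>
          Finset.sum_nonneg fun n _ => tn k m n) ⟨k, Finset.mem_range.2 (by omega), ?_⟩
        refine Finset.sum_pos' (fun m _ =>
          Finset.sum_nonneg fun n _ => tn k m n) ⟨M, Finset.mem_range.2 (by omega), ?_⟩
        refine Finset.sum_pos' (fun n _ => tn k M n) ⟨M, Finset.mem_range.2 (by omega), ?_⟩
        dsimp only
        rw [if_neg (by omega)]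
        exact mul_pos hk (mul_pos hp0 (sub_pos.2 hGR))
      linarith
  intro t ht _
  have := key (t - 1)
  rw [if_neg (by omega)] at this
  unfold probChoose1GM
  rw [qq] at this
  rw [this]

end BayesianChoice
end
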